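/- Assume f₀ : 𝒳ⁿ → ℝⁿ is Lipschitz on bounded sets with f₀(0) = 0. Suppose there exist a functional V : 𝒳ⁿ → [0,∞) Lipschitz on bounded sets and constants a₁, a₂, a > 0 and ε ≥ 0 such that for all φ ∈ 𝒳ⁿ: a₁|φ(0)|² ≤ V(φ) ≤ a₂‖φ‖² and D⁺V(φ, f₀(φ)) ≤ −a|φ(0)|² + ε‖φ‖². Suppose further that there exist a symmetric positive definite matrix P ∈ ℝⁿˣⁿ and a constant c > 0 such that either φ(0)ᵀ P f₀(φ) ≤ c‖φ‖² for all φ ∈ 𝒳ⁿ, or φ(0)ᵀ P f₀(φ) ≥ −c‖φ‖² for all φ ∈ 𝒳ⁿ. Then there exists ε̄ > 0 such that if ε ∈ [0, ε̄), the system ẋ(t) = f₀(x_t) is GES. -/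

import Mathlib

open Set Filter MeasureTheory Topology
open scoped NNReal

noncomputable section

/-- `ℝⁿ` with the Euclidean norm. -/
abbrev Vec (n : ℕ) : Type := EuclideanSpace ℝ (Fin n)

/-- The state space `𝒳ⁿ = C([-Δ,0], ℝⁿ)`, equipped with the sup norm. -/
abbrev Hist (Δ : ℝ≥0) (n : ℕ) : Type :=
  ContinuousMap (Icc (-(Δ : ℝ)) (0 : ℝ)) (Vec n)

theorem zero_mem_IccD (Δ : ℝ≥0) : (0 : ℝ) ∈ Icc (-(Δ : ℝ)) (0 : ℝ) :=
  ⟨neg_nonpos.mpr Δ.coe_nonneg, le_refl 0⟩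

/-- `φ(0)`: the current value of a history segment. -/
def ev0 {Δ : ℝ≥0} {n : ℕ} (φ : Hist Δ n) : Vec n :=
  φ ⟨0, zero_mem_IccD Δ⟩

/-! ### Comparison functions -/

/-- Class `𝒦`: continuous, strictly increasing, zero at zero (on `[0,∞)`). -/
def ClassK (α : ℝ → ℝ) : Prop :=
  ContinuousOn α (Ici 0) ∧ StrictMonoOn α (Ici 0) ∧ α 0 = 0

/-- Class `𝒦∞`: class `𝒦` and unbounded. -/
def ClassKinf (α : ℝ → ℝ) : Prop :=
  ClassK α ∧ Tendsto α atTop atTop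

/-- Class `𝒩`: continuous, nondecreasing, zero at zero (on `[0,∞)`). -/
def ClassN (α : ℝ → ℝ) : Prop :=
  ContinuousOn α (Ici 0) ∧ MonotoneOn α (Ici 0) ∧ α 0 = 0

/-- Class `𝒫`: continuous, zero at zero, positive on `(0,∞)`. -/
def ClassP (α : ℝ → ℝ) : Prop :=
  ContinuousOn α (Ici 0) ∧ α 0 = 0 ∧ ∀ s : ℝ, 0 < s → 0 < α s

/-- Class `𝒦ℒ`. -/
def ClassKL (β : ℝ → ℝ → ℝ) : Prop :=
  (∀ t : ℝ, 0 ≤ t → ClassK fun s => β s t) ∧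
    ∀ s : ℝ, 0 ≤ s →
      ContinuousOn (β s) (Ici 0) ∧ AntitoneOn (β s) (Ici 0) ∧
        Tendsto (β s) atTop (𝓝 0)

/-! ### Inputs -/

/-- Admissible input: Lebesgue measurable and locally essentially bounded. -/
def IsInput {m : ℕ} (u : ℝ → Vec m) : Prop :=
  Measurable u ∧ ∀ T : ℝ, 0 < T → ∃ C : ℝ, ∀ᵐ t ∂volume, t ∈ Icc (0 : ℝ) T → ‖u t‖ ≤ C

/-- Essential supremum of `‖u‖` over a set of times. -/
def essBnd {m : ℕ} (u : ℝ → Vec m) (s : Set ℝ) : ℝ :=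
  sInf {C : ℝ | 0 ≤ C ∧ ∀ᵐ τ ∂volume, τ ∈ s → ‖u τ‖ ≤ C}

/-! ### History segments along a trajectory -/

-- The history segment `x_t ∈ 𝒳ⁿ` of a trajectory `x : ℝ → ℝⁿ` (with junk value `0`
-- when `x` is not continuous on `[t-Δ, t]`).
open Classical in
def seg (Δ : ℝ≥0) {n : ℕ} (x : ℝ → Vec n) (t : ℝ) : Hist Δ n :=
  if hx : ContinuousOn x (Icc (t - (Δ : ℝ)) t) then
    { toFun := fun τ => x (t + τ.1)
      continuous_toFun := by
        have h1 : Continuous fun τ : Icc (-(Δ : ℝ)) (0 : ℝ) => t + τ.1 :=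
          continuous_const.add continuous_subtype_val
        have h2 : ∀ τ : Icc (-(Δ : ℝ)) (0 : ℝ), t + τ.1 ∈ Icc (t - (Δ : ℝ)) t := by
          rintro ⟨τ, hτ⟩
          rw [mem_Icc] at hτ ⊢
          constructor
          · linarith [hτ.1]
          · linarith [hτ.2]
        exact hx.comp_continuous h1 h2 }
  else 0

/-! ### Driver's derivative and Dini derivative -/

/-- The deformed history `φ_{h,w}` appearing in Driver's derivative: for `0 ≤ h < Δ`,
`φ_{h,w}(s) = φ(s+h)` for `s ∈ [-Δ,-h)` and `φ_{h,w}(s) = φ(0) + w(h+s)` for `s ∈ [-h,0]`. -/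
def shiftSeg {Δ : ℝ≥0} {n : ℕ} (φ : Hist Δ n) (w : Vec n) (h : ℝ) : Hist Δ n :=
  { toFun := fun s =>
      φ (projIcc (-(Δ : ℝ)) 0 (neg_nonpos.mpr Δ.coe_nonneg) (s.1 + h)) + max (h + s.1) 0 • w
    continuous_toFun := by
      refine Continuous.add ?_ ?_
      · exact φ.continuous.comp (continuous_projIcc.comp
          (continuous_subtype_val.add continuous_const))
      · exact ((continuous_const.add continuous_subtype_val).max continuous_const).smul
          continuous_const }

/-- Driver's derivative `D⁺V(φ,w)`, valued in the extended reals. -/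
def driverD {Δ : ℝ≥0} {n : ℕ} (V : Hist Δ n → ℝ) (φ : Hist Δ n) (w : Vec n) : EReal :=
  limsup (fun h : ℝ => (((V (shiftSeg φ w h) - V φ) / h : ℝ) : EReal)) (𝓝[>] (0 : ℝ))

/-- Upper right-hand Dini derivative of `ν : ℝ → ℝ`, valued in the extended reals. -/
def diniD (ν : ℝ → ℝ) (t : ℝ) : EReal :=
  limsup (fun h : ℝ => (((ν (t + h) - ν t) / h : ℝ) : EReal)) (𝓝[>] (0 : ℝ))

/-! ### Lipschitz conditions -/

/-- `f : 𝒳ⁿ × ℝᵐ → ℝⁿ` is Lipschitz on bounded sets. -/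
def LipOnBounded {Δ : ℝ≥0} {n m : ℕ} (f : Hist Δ n → Vec m → Vec n) : Prop :=
  ∀ r : ℝ, 0 < r → ∃ L : ℝ, 0 < L ∧
    ∀ (φ₁ φ₂ : Hist Δ n) (v₁ v₂ : Vec m),
      ‖φ₁‖ ≤ r → ‖φ₂‖ ≤ r → ‖v₁‖ ≤ r → ‖v₂‖ ≤ r →
        ‖f φ₁ v₁ - f φ₂ v₂‖ ≤ L * (‖φ₁ - φ₂‖ + ‖v₁ - v₂‖)

/-- An input-free vector field `f₀ : 𝒳ⁿ → ℝⁿ` Lipschitz on bounded sets. -/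
def LipOnBounded₀ {Δ : ℝ≥0} {n : ℕ} (f₀ : Hist Δ n → Vec n) : Prop :=
  ∀ r : ℝ, 0 < r → ∃ L : ℝ, 0 < L ∧
    ∀ φ₁ φ₂ : Hist Δ n, ‖φ₁‖ ≤ r → ‖φ₂‖ ≤ r → ‖f₀ φ₁ - f₀ φ₂‖ ≤ L * ‖φ₁ - φ₂‖

/-- A functional `V : 𝒳ⁿ → ℝ` Lipschitz on bounded sets. -/
def LipOnBoundedV {Δ : ℝ≥0} {n : ℕ} (V : Hist Δ n → ℝ) : Prop :=
  ∀ r : ℝ, 0 < r → ∃ L : ℝ, 0 < L ∧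
    ∀ φ₁ φ₂ : Hist Δ n, ‖φ₁‖ ≤ r → ‖φ₂‖ ≤ r → |V φ₁ - V φ₂| ≤ L * ‖φ₁ - φ₂‖

/-- A functional `V : 𝒳ⁿ → ℝ` locally Lipschitz. -/
def LocallyLipV {Δ : ℝ≥0} {n : ℕ} (V : Hist Δ n → ℝ) : Prop :=
  ∀ φ : Hist Δ n, ∃ δ : ℝ, 0 < δ ∧ ∃ L : ℝ, 0 < L ∧
    ∀ φ₁ φ₂ : Hist Δ n, ‖φ₁ - φ‖ ≤ δ → ‖φ₂ - φ‖ ≤ δ → |V φ₁ - V φ₂| ≤ L * ‖φ₁ - φ₂‖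

/-! ### Solutions -/

/-- `x` is a solution of `ẋ(t) = f(x_t, u(t))` with initial state `x₀` on `[0, tmax)`. -/
structure IsSolution (Δ : ℝ≥0) {n m : ℕ} (f : Hist Δ n → Vec m → Vec n)
    (u : ℝ → Vec m) (x₀ : Hist Δ n) (tmax : EReal) (x : ℝ → Vec n) : Prop where
  tmax_pos : 0 < tmax
  cont : ContinuousOn x {s : ℝ | -(Δ : ℝ) ≤ s ∧ (s : EReal) < tmax}
  init : ∀ τ : Icc (-(Δ : ℝ)) (0 : ℝ), x τ.1 = x₀ τ
  integrable : ∀ t : ℝ, 0 ≤ t → (t : EReal) < tmax →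
    IntervalIntegrable (fun s => f (seg Δ x s) (u s)) volume 0 t
  integral_eq : ∀ t : ℝ, 0 ≤ t → (t : EReal) < tmax →
    x t = x 0 + ∫ s in (0:ℝ)..t, f (seg Δ x s) (u s)

/-- Maximal solution: a solution admitting no proper extension. -/
def IsMaxSolution (Δ : ℝ≥0) {n m : ℕ} (f : Hist Δ n → Vec m → Vec n)
    (u : ℝ → Vec m) (x₀ : Hist Δ n) (tmax : EReal) (x : ℝ → Vec n) : Prop :=
  IsSolution Δ f u x₀ tmax x ∧
    ∀ (tmax' : EReal) (x' : ℝ → Vec n), IsSolution Δ f u x₀ tmax' x' →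
      (∀ t : ℝ, -(Δ : ℝ) ≤ t → (t : EReal) < tmax → x' t = x t) → tmax' ≤ tmax

/-- Solution of the input-free system `ẋ(t) = f₀(x_t)`. -/
def IsSolution₀ (Δ : ℝ≥0) {n : ℕ} (f₀ : Hist Δ n → Vec n) (x₀ : Hist Δ n)
    (tmax : EReal) (x : ℝ → Vec n) : Prop :=
  IsSolution Δ (fun φ (_ : Vec 0) => f₀ φ) (fun _ => 0) x₀ tmax x

/-- Maximal solution of the input-free system `ẋ(t) = f₀(x_t)`. -/
def IsMaxSolution₀ (Δ : ℝ≥0) {n : ℕ} (f₀ : Hist Δ n → Vec n) (x₀ : Hist Δ n)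
    (tmax : EReal) (x : ℝ → Vec n) : Prop :=
  IsMaxSolution Δ (fun φ (_ : Vec 0) => f₀ φ) (fun _ => 0) x₀ tmax x

/-! ### Stability properties (input-free systems) -/

/-- Global asymptotic stability (GAS). -/
def GAS (Δ : ℝ≥0) {n : ℕ} (f₀ : Hist Δ n → Vec n) : Prop :=
  ∃ β : ℝ → ℝ → ℝ, ClassKL β ∧
    ∀ (x₀ : Hist Δ n) (tmax : EReal) (x : ℝ → Vec n),
      IsMaxSolution₀ Δ f₀ x₀ tmax x →
        tmax = ⊤ ∧ ∀ t : ℝ, 0 ≤ t → ‖x t‖ ≤ β ‖x₀‖ t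

/-- Global exponential stability (GES). -/
def GES (Δ : ℝ≥0) {n : ℕ} (f₀ : Hist Δ n → Vec n) : Prop :=
  ∃ k : ℝ, 1 ≤ k ∧ ∃ lam : ℝ, 0 < lam ∧
    ∀ (x₀ : Hist Δ n) (tmax : EReal) (x : ℝ → Vec n),
      IsMaxSolution₀ Δ f₀ x₀ tmax x →
        tmax = ⊤ ∧ ∀ t : ℝ, 0 ≤ t → ‖x t‖ ≤ k * ‖x₀‖ * Real.exp (-lam * t)

/-- (Local) asymptotic stability (AS) of the origin. -/
def AS (Δ : ℝ≥0) {n : ℕ} (f₀ : Hist Δ n → Vec n) : Prop :=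
  ∃ r : ℝ, 0 < r ∧ ∃ β : ℝ → ℝ → ℝ, ClassKL β ∧
    ∀ (x₀ : Hist Δ n) (tmax : EReal) (x : ℝ → Vec n),
      IsMaxSolution₀ Δ f₀ x₀ tmax x → ‖x₀‖ ≤ r →
        tmax = ⊤ ∧ ∀ t : ℝ, 0 ≤ t → ‖x t‖ ≤ β ‖x₀‖ t

/-- (Local) exponential stability (ES) of the origin. -/
def ES (Δ : ℝ≥0) {n : ℕ} (f₀ : Hist Δ n → Vec n) : Prop :=
  ∃ r : ℝ, 0 < r ∧ ∃ k : ℝ, 1 ≤ k ∧ ∃ lam : ℝ, 0 < lam ∧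
    ∀ (x₀ : Hist Δ n) (tmax : EReal) (x : ℝ → Vec n),
      IsMaxSolution₀ Δ f₀ x₀ tmax x → ‖x₀‖ ≤ r →
        tmax = ⊤ ∧ ∀ t : ℝ, 0 ≤ t → ‖x t‖ ≤ k * ‖x₀‖ * Real.exp (-lam * t)

/-! ### Forward completeness -/

/-- Robust forward completeness (RFC) of `ẋ(t) = f(x_t,u(t))`. -/
def RFC (Δ : ℝ≥0) {n m : ℕ} (f : Hist Δ n → Vec m → Vec n) : Prop :=
  (∀ (x₀ : Hist Δ n) (u : ℝ → Vec m) (tmax : EReal) (x : ℝ → Vec n),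
      IsInput u → IsMaxSolution Δ f u x₀ tmax x → tmax = ⊤) ∧
    ∀ T : ℝ, 0 < T → ∀ r : ℝ, 0 < r → ∃ C : ℝ,
      ∀ (x₀ : Hist Δ n) (u : ℝ → Vec m) (tmax : EReal) (x : ℝ → Vec n),
        IsInput u → IsMaxSolution Δ f u x₀ tmax x →
          ‖x₀‖ ≤ r → essBnd u (Ici 0) ≤ r →
            ∀ t : ℝ, t ∈ Icc (0 : ℝ) T → ‖seg Δ x t‖ ≤ C

/-- Robust forward completeness of the input-free system `ẋ(t) = f₀(x_t)`. -/
def RFC₀ (Δ : ℝ≥0) {n : ℕ} (f₀ : Hist Δ n → Vec n) : Prop :=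
  RFC Δ (fun φ (_ : Vec 0) => f₀ φ)

/-! ### Input-to-state stability notions -/

/-- Input-to-state stability (ISS). -/
def ISS (Δ : ℝ≥0) {n m : ℕ} (f : Hist Δ n → Vec m → Vec n) : Prop :=
  ∃ β : ℝ → ℝ → ℝ, ∃ μ : ℝ → ℝ, ClassKL β ∧ ClassN μ ∧
    ∀ (x₀ : Hist Δ n) (u : ℝ → Vec m) (tmax : EReal) (x : ℝ → Vec n),
      IsInput u → IsMaxSolution Δ f u x₀ tmax x →
        tmax = ⊤ ∧ ∀ t : ℝ, 0 ≤ t → ‖x t‖ ≤ β ‖x₀‖ t + μ (essBnd u (Icc 0 t))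

/-- Local input-to-state stability (LISS). -/
def LISS (Δ : ℝ≥0) {n m : ℕ} (f : Hist Δ n → Vec m → Vec n) : Prop :=
  ∃ r : ℝ, 0 < r ∧ ∃ β : ℝ → ℝ → ℝ, ∃ μ : ℝ → ℝ, ClassKL β ∧ ClassN μ ∧
    ∀ (x₀ : Hist Δ n) (u : ℝ → Vec m) (tmax : EReal) (x : ℝ → Vec n),
      IsInput u → IsMaxSolution Δ f u x₀ tmax x →
        ‖x₀‖ ≤ r → essBnd u (Ici 0) ≤ r →
          tmax = ⊤ ∧ ∀ t : ℝ, 0 ≤ t → ‖x t‖ ≤ β ‖x₀‖ t + μ (essBnd u (Icc 0 t))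

/-- Integral input-to-state stability (iISS). -/
def iISS (Δ : ℝ≥0) {n m : ℕ} (f : Hist Δ n → Vec m → Vec n) : Prop :=
  ∃ β : ℝ → ℝ → ℝ, ∃ η μ : ℝ → ℝ, ClassKL β ∧ ClassN η ∧ ClassN μ ∧
    ∀ (x₀ : Hist Δ n) (u : ℝ → Vec m) (tmax : EReal) (x : ℝ → Vec n),
      IsInput u → IsMaxSolution Δ f u x₀ tmax x →
        tmax = ⊤ ∧ ∀ t : ℝ, 0 ≤ t →
          ‖x t‖ ≤ β ‖x₀‖ t + η (∫ s in (0:ℝ)..t, μ ‖u s‖)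

/-- The UBEBS estimate with offset `c`. -/
def UBEBSwith (Δ : ℝ≥0) {n m : ℕ} (f : Hist Δ n → Vec m → Vec n) (c : ℝ) : Prop :=
  ∃ α ξ ζ : ℝ → ℝ, ClassKinf α ∧ ClassKinf ξ ∧ ClassKinf ζ ∧
    ∀ (x₀ : Hist Δ n) (u : ℝ → Vec m) (tmax : EReal) (x : ℝ → Vec n),
      IsInput u → IsMaxSolution Δ f u x₀ tmax x →
        tmax = ⊤ ∧ ∀ t : ℝ, 0 ≤ t →
          α ‖x t‖ ≤ ξ ‖x₀‖ + (∫ s in (0:ℝ)..t, ζ ‖u s‖) + c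

/-! ### Lyapunov–Krasovskii functionals -/

/-- Lyapunov–Krasovskii functional candidate (LKF). -/
def IsLKF {Δ : ℝ≥0} {n : ℕ} (V : Hist Δ n → ℝ) : Prop :=
  (∀ φ, 0 ≤ V φ) ∧ LipOnBoundedV V ∧
    ∃ α₁ α₂ : ℝ → ℝ, ClassKinf α₁ ∧ ClassKinf α₂ ∧
      ∀ φ : Hist Δ n, α₁ ‖ev0 φ‖ ≤ V φ ∧ V φ ≤ α₂ ‖φ‖

/-- Coercive Lyapunov–Krasovskii functional candidate. -/
def IsCoerciveLKF {Δ : ℝ≥0} {n : ℕ} (V : Hist Δ n → ℝ) : Prop :=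
  (∀ φ, 0 ≤ V φ) ∧ LipOnBoundedV V ∧
    ∃ α₁ α₂ : ℝ → ℝ, ClassKinf α₁ ∧ ClassKinf α₂ ∧
      ∀ φ : Hist Δ n, α₁ ‖φ‖ ≤ V φ ∧ V φ ≤ α₂ ‖φ‖

end

/-! ### History segments of globally continuous curves -/

/-- The history segment at time `t` of a curve that is continuous on all of `ℝ`. -/
def histAt (Δ : ℝ≥0) {n : ℕ} (x : C(ℝ, Vec n)) (t : ℝ) : Hist Δ n :=
  ⟨fun τ => x (t + τ.1), by fun_prop⟩

theorem continuous_histAt (Δ : ℝ≥0) {n : ℕ} (x : C(ℝ, Vec n)) :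
    Continuous (histAt Δ x) :=
  ContinuousMap.continuous_of_continuous_uncurry _ (by
    change Continuous fun p : ℝ × Icc (-(Δ : ℝ)) (0 : ℝ) => x (p.1 + p.2.1)
    fun_prop)

@[simp]
theorem ev0_histAt (Δ : ℝ≥0) {n : ℕ} (x : C(ℝ, Vec n)) (t : ℝ) :
    ev0 (histAt Δ x t) = x t := by
  simp [ev0, histAt]

theorem norm_apply_le_norm_histAt {Δ : ℝ≥0} {n : ℕ} (x : C(ℝ, Vec n)) {s t : ℝ}
    (h₁ : t - Δ ≤ s) (h₂ : s ≤ t) : ‖x s‖ ≤ ‖histAt Δ x t‖ := by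
  have := (histAt Δ x t).norm_coe_le_norm ⟨s - t, by constructor <;> linarith⟩
  simpa [histAt] using this

theorem norm_histAt_le {Δ : ℝ≥0} {n : ℕ} (x : C(ℝ, Vec n)) {t C : ℝ} (hC : 0 ≤ C)
    (h : ∀ s ∈ Icc (t - (Δ : ℝ)) t, ‖x s‖ ≤ C) : ‖histAt Δ x t‖ ≤ C := by
  rw [ContinuousMap.norm_le _ hC]
  rintro ⟨τ, hτ⟩
  exact h _ ⟨by linarith [hτ.1], by linarith [hτ.2]⟩

theorem histAt_congr {Δ : ℝ≥0} {n : ℕ} {x y : C(ℝ, Vec n)} {t : ℝ}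
    (h : ∀ s ∈ Icc (t - (Δ : ℝ)) t, x s = y s) : histAt Δ x t = histAt Δ y t := by
  ext1 ⟨τ, hτ⟩
  exact h _ ⟨by linarith [hτ.1], by linarith [hτ.2]⟩

theorem seg_eq_histAt {Δ : ℝ≥0} {n : ℕ} {x : ℝ → Vec n} {y : C(ℝ, Vec n)} {t : ℝ}
    (h : ∀ s ∈ Icc (t - (Δ : ℝ)) t, x s = y s) : seg Δ x t = histAt Δ y t := by
  have hx : ContinuousOn x (Icc (t - (Δ : ℝ)) t) := y.continuous.continuousOn.congr h
  ext1 ⟨τ, hτ⟩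
  simp only [seg, dif_pos hx]
  exact h _ ⟨by linarith [hτ.1], by linarith [hτ.2]⟩

theorem LipOnBounded₀.continuous {Δ : ℝ≥0} {n : ℕ} {f₀ : Hist Δ n → Vec n}
    (hf : LipOnBounded₀ f₀) : Continuous f₀ := by
  rw [continuous_iff_continuousAt]
  intro φ
  obtain ⟨L, hL, h⟩ := hf (‖φ‖ + 1) (by positivity)
  have hlip : LipschitzOnWith L.toNNReal f₀ (Metric.closedBall 0 (‖φ‖ + 1)) :=
    LipschitzOnWith.of_dist_le_mul fun a ha b hb => by
      rw [dist_eq_norm, dist_eq_norm, Real.coe_toNNReal _ hL.le]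
      exact h a b (by simpa using ha) (by simpa using hb)
  refine hlip.continuousOn.continuousAt (Metric.closedBall_mem_nhds_of_mem ?_)
  simp

theorem LipOnBoundedV.continuous {Δ : ℝ≥0} {n : ℕ} {V : Hist Δ n → ℝ}
    (hV : LipOnBoundedV V) : Continuous V := by
  rw [continuous_iff_continuousAt]
  intro φ
  obtain ⟨L, hL, h⟩ := hV (‖φ‖ + 1) (by positivity)
  have hlip : LipschitzOnWith L.toNNReal V (Metric.closedBall 0 (‖φ‖ + 1)) :=
    LipschitzOnWith.of_dist_le_mul fun a ha b hb => by
      rw [Real.dist_eq, dist_eq_norm, Real.coe_toNNReal _ hL.le]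
      exact h a b (by simpa using ha) (by simpa using hb)
  refine hlip.continuousOn.continuousAt (Metric.closedBall_mem_nhds_of_mem ?_)
  simp

/-- The curve `x` solves `ẋ(t) = f₀(x_t)` in integral form on `[0, b]`. -/
def IsTrajectory {Δ : ℝ≥0} {n : ℕ} (f₀ : Hist Δ n → Vec n) (x : C(ℝ, Vec n)) (b : ℝ) : Prop :=
  ∀ t ∈ Icc 0 b, x t = x 0 + ∫ s in (0 : ℝ)..t, f₀ (histAt Δ x s)

theorem IsTrajectory.hasDerivWithinAt {Δ : ℝ≥0} {n : ℕ} {f₀ : Hist Δ n → Vec n}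
    {x : C(ℝ, Vec n)} {b : ℝ} (hx : IsTrajectory f₀ x b) (hf : Continuous f₀) {t : ℝ}
    (ht : t ∈ Ico 0 b) : HasDerivWithinAt x (f₀ (histAt Δ x t)) (Ici t) t := by
  have hc : Continuous fun s => f₀ (histAt Δ x s) := hf.comp (continuous_histAt Δ x)
  have h := ((hc.integral_hasStrictDerivAt 0 t).hasDerivAt.const_add (x 0)).hasDerivWithinAt
    (s := Ici t)
  refine h.congr_of_eventuallyEq ?_ (hx t ⟨ht.1, ht.2.le⟩)
  filter_upwards [Icc_mem_nhdsGE ht.2] with s hs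
  exact hx s ⟨ht.1.trans hs.1, hs.2⟩

/-- The true future history and the affinely deformed one differ by `o(h)`. -/
theorem eventually_norm_histAt_sub_shiftSeg_le {Δ : ℝ≥0} {n : ℕ} {x : C(ℝ, Vec n)} {t : ℝ}
    {w : Vec n} (hx : HasDerivWithinAt x w (Ici t) t) {e : ℝ} (he : 0 < e) :
    ∀ᶠ h in 𝓝[>] (0 : ℝ), ‖histAt Δ x (t + h) - shiftSeg (histAt Δ x t) w h‖ ≤ e * h := by
  have h₁ := (hasDerivWithinAt_iff_isLittleO.1 hx).bound he
  rw [eventually_nhdsWithin_iff, Metric.eventually_nhds_iff] at h₁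
  obtain ⟨δ, hδ, h₁⟩ := h₁
  filter_upwards [Ioo_mem_nhdsGT hδ] with h hh
  have hh0 : 0 < h := hh.1
  rw [ContinuousMap.norm_le _ (by positivity)]
  rintro ⟨τ, hτ⟩
  simp only [ContinuousMap.sub_apply, histAt, shiftSeg, ContinuousMap.coe_mk]
  rcases le_total (τ + h) 0 with hle | hge
  · rw [projIcc_of_mem _ (⟨by linarith [hτ.1], hle⟩ : τ + h ∈ Icc (-(Δ : ℝ)) 0),
      max_eq_right (by linarith)]
    simp only [zero_smul, add_zero]
    rw [show t + h + τ = t + (τ + h) by ring, sub_self, norm_zero]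
    positivity
  · rw [projIcc_of_right_le _ hge, max_eq_left (by linarith)]
    have h₂ := @h₁ (t + h + τ) (by
      rw [Real.dist_eq, show t + h + τ - t = h + τ by ring, abs_of_nonneg (by linarith)]
      linarith [hτ.2, hh.2]) (by simp only [mem_Ici]; linarith)
    rw [show t + h + τ - t = h + τ by ring, Real.norm_of_nonneg (by linarith)] at h₂
    simp only [add_zero]
    rw [← sub_sub]
    exact h₂.trans (mul_le_mul_of_nonneg_left (by linarith [hτ.2]) he.le)

theorem eventually_slope_lt_of_driverD_le {Δ : ℝ≥0} {n : ℕ} {V : Hist Δ n → ℝ}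
    (hV : LipOnBoundedV V) {x : C(ℝ, Vec n)} {t : ℝ} {w : Vec n}
    (hx : HasDerivWithinAt x w (Ici t) t) {C r : ℝ} (hC : driverD V (histAt Δ x t) w ≤ (C : EReal))
    (hr : C < r) : ∀ᶠ s in 𝓝[>] t, slope (fun s => V (histAt Δ x s)) t s < r := by
  obtain ⟨q, hCq, hqr⟩ := exists_between hr
  have h₁ : ∀ᶠ h in 𝓝[>] (0 : ℝ),
      (((V (shiftSeg (histAt Δ x t) w h) - V (histAt Δ x t)) / h : ℝ) : EReal) < (q : EReal) :=
    eventually_lt_of_limsup_lt (hC.trans_lt (EReal.coe_lt_coe_iff.2 hCq))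
  set R : ℝ := ‖histAt Δ x t‖ + 1
  obtain ⟨L, hL, hlip⟩ := hV (R + 1) (by positivity)
  have he : 0 < (r - q) / L := div_pos (by linarith) hL
  have h₂ := eventually_norm_histAt_sub_shiftSeg_le (Δ := Δ) hx he
  have h₃ : ∀ᶠ h in 𝓝[>] (0 : ℝ), ‖histAt Δ x (t + h)‖ < R := by
    have hc : Continuous fun h => ‖histAt Δ x (t + h)‖ :=
      ((continuous_histAt Δ x).comp (continuous_const.add continuous_id)).norm
    refine (hc.tendsto 0).eventually_lt_const (by simp [R]) |>.filter_mono nhdsWithin_le_nhds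
  have h₄ : ∀ᶠ h in 𝓝[>] (0 : ℝ), (r - q) / L * h < 1 := by
    have hc : Continuous fun h : ℝ => (r - q) / L * h := by fun_prop
    refine (hc.tendsto 0).eventually_lt_const (by simp) |>.filter_mono nhdsWithin_le_nhds
  have key : ∀ᶠ h in 𝓝[>] (0 : ℝ), slope (fun s => V (histAt Δ x s)) t (t + h) < r := by
    filter_upwards [h₁, h₂, h₃, h₄, self_mem_nhdsWithin] with h h₁ h₂ h₃ h₄ hpos
    have hpos : 0 < h := hpos
    have hs : ‖shiftSeg (histAt Δ x t) w h‖ ≤ R + 1 := by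
      have := norm_sub_norm_le (shiftSeg (histAt Δ x t) w h) (histAt Δ x (t + h))
      rw [norm_sub_rev] at this
      linarith
    have hd := (le_abs_self _).trans (hlip _ _ (by linarith : ‖histAt Δ x (t + h)‖ ≤ R + 1) hs)
    have h₅ : L * ‖histAt Δ x (t + h) - shiftSeg (histAt Δ x t) w h‖ ≤ (r - q) * h := by
      calc _ ≤ L * ((r - q) / L * h) := mul_le_mul_of_nonneg_left h₂ hL.le
        _ = (r - q) * h := by field_simp
    rw [EReal.coe_lt_coe_iff, div_lt_iff₀ hpos] at h₁
    rw [slope_def_field, add_sub_cancel_left, div_lt_iff₀ hpos]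
    linarith
  have hmap : Tendsto (fun s => s - t) (𝓝[>] t) (𝓝[>] 0) := by
    refine tendsto_nhdsWithin_iff.2 ⟨?_, ?_⟩
    · have hc : Continuous fun s : ℝ => s - t := by fun_prop
      simpa using (hc.tendsto t).mono_left nhdsWithin_le_nhds
    · filter_upwards [self_mem_nhdsWithin] with s hs
      exact mem_Ioi.2 (sub_pos.2 (mem_Ioi.1 hs))
  filter_upwards [hmap.eventually key] with s hs
  simpa using hs

/-- Along the curve `x` the function `ν` lies between quadratic bounds and dissipates. -/
structure DissipatesAlong (Δ : ℝ≥0) {n : ℕ} (a₁ a₂ a ε b : ℝ) (ν : ℝ → ℝ) (x : C(ℝ, Vec n)) :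
    Prop where
  nonneg : ∀ t, 0 ≤ ν t
  lower : ∀ t, a₁ * ‖x t‖ ^ 2 ≤ ν t
  upper : ∀ t, ν t ≤ a₂ * ‖histAt Δ x t‖ ^ 2
  le_add_mul : ∀ ⦃t₁ t₂ C : ℝ⦄, 0 ≤ t₁ → t₁ ≤ t₂ → t₂ ≤ b →
    (∀ t ∈ Ico t₁ t₂, -(a * ‖x t‖ ^ 2) + ε * ‖histAt Δ x t‖ ^ 2 ≤ C) →
      ν t₂ ≤ ν t₁ + C * (t₂ - t₁)

theorem IsTrajectory.dissipatesAlong {Δ : ℝ≥0} {n : ℕ} {f₀ : Hist Δ n → Vec n}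
    {x : C(ℝ, Vec n)} {b : ℝ} (hx : IsTrajectory f₀ x b) (hf : Continuous f₀)
    {V : Hist Δ n → ℝ} (hVnonneg : ∀ φ, 0 ≤ V φ) (hVlip : LipOnBoundedV V) {a₁ a₂ a ε : ℝ}
    (hbounds : ∀ φ : Hist Δ n, a₁ * ‖ev0 φ‖ ^ 2 ≤ V φ ∧ V φ ≤ a₂ * ‖φ‖ ^ 2)
    (hdiss : ∀ φ : Hist Δ n, driverD V φ (f₀ φ)
          ≤ ((-(a * ‖ev0 φ‖ ^ 2) + ε * ‖φ‖ ^ 2 : ℝ) : EReal)) :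
    DissipatesAlong Δ a₁ a₂ a ε b (fun t => V (histAt Δ x t)) x where
  nonneg t := hVnonneg _
  lower t := by simpa using (hbounds (histAt Δ x t)).1
  upper t := (hbounds _).2
  le_add_mul := by
    intro t₁ t₂ C h0 h12 h2b hC
    refine image_le_of_liminf_slope_right_le_deriv_boundary
      (f := fun t => V (histAt Δ x t)) (B := fun t => V (histAt Δ x t₁) + C * (t - t₁))
      (B' := fun _ => C) (a := t₁) (b := t₂)
      (hVlip.continuous.comp (continuous_histAt Δ x)).continuousOn (by simp) (by fun_prop) ?_ ?_
      ⟨h12, le_rfl⟩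
    · intro t _
      simpa using ((((hasDerivAt_id t).sub_const t₁).const_mul C).const_add
        (V (histAt Δ x t₁))).hasDerivWithinAt
    · intro t ht r hr
      have hd := hdiss (histAt Δ x t)
      rw [ev0_histAt] at hd
      exact (eventually_slope_lt_of_driverD_le hVlip
        (hx.hasDerivWithinAt hf ⟨h0.trans ht.1, ht.2.trans_le h2b⟩)
        (hd.trans (EReal.coe_le_coe_iff.2 (hC t ht))) hr).frequently

theorem norm_histAt_sq_le {Δ : ℝ≥0} {n : ℕ} (x : C(ℝ, Vec n)) {t Q : ℝ}
    (h : ∀ s ∈ Icc (t - (Δ : ℝ)) t, ‖x s‖ ^ 2 ≤ Q) : ‖histAt Δ x t‖ ^ 2 ≤ Q := by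
  have hQ : 0 ≤ Q := (sq_nonneg _).trans (h t ⟨by linarith [Δ.coe_nonneg], le_rfl⟩)
  have := norm_histAt_le x (Real.sqrt_nonneg Q) fun s hs => Real.le_sqrt_of_sq_le (h s hs)
  calc ‖histAt Δ x t‖ ^ 2 ≤ (√Q) ^ 2 := by gcongr
    _ = Q := Real.sq_sqrt hQ

namespace DissipatesAlong

variable {Δ : ℝ≥0} {n : ℕ} {a₁ a₂ a ε b : ℝ} {ν : ℝ → ℝ} {x : C(ℝ, Vec n)}

/-- Growth estimate over a time horizon that is short relative to the perturbation `ε`. -/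
theorem norm_histAt_sq_le (h : DissipatesAlong Δ a₁ a₂ a ε b ν x) (ha₁ : 0 < a₁) (ha₂ : 0 < a₂)
    (ha : 0 < a) (hε : 0 ≤ ε) {T t₀ t : ℝ} (hεT : ε * T ≤ a₁ / 2) (h₀ : 0 ≤ t₀)
    (ht₀ : t₀ ≤ t) (htT : t ≤ t₀ + T) (htb : t ≤ b) :
    ‖histAt Δ x t‖ ^ 2 ≤ (1 + 2 * (a₂ / a₁)) * ‖histAt Δ x t₀‖ ^ 2 := by
  obtain ⟨s, hs, hmax⟩ := (isCompact_Icc (a := t₀) (b := t)).exists_isMaxOn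
    (nonempty_Icc.2 ht₀) ((continuous_histAt Δ x).norm.pow 2).continuousOn
  set r := ‖histAt Δ x t₀‖
  set m := ‖histAt Δ x s‖ ^ 2
  have hm : ∀ u ∈ Icc t₀ t, ‖histAt Δ x u‖ ^ 2 ≤ m := fun u hu => hmax hu
  have hm0 : 0 ≤ m := by positivity
  have hbd : ∀ u ∈ Icc t₀ t, ‖x u‖ ^ 2 ≤ a₂ / a₁ * r ^ 2 + m / 2 := by
    intro u hu
    have h1 := h.le_add_mul (C := ε * m) h₀ hu.1 (hu.2.trans htb) fun v hv => by
      have := mul_le_mul_of_nonneg_left (hm v ⟨hv.1, hv.2.le.trans hu.2⟩) hε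
      have : 0 ≤ a * ‖x v‖ ^ 2 := by positivity
      linarith
    have h2 := h.lower u
    have h3 := h.upper t₀
    have h4 : ε * m * (u - t₀) ≤ a₁ / 2 * m := by
      have : ε * (u - t₀) ≤ ε * T := mul_le_mul_of_nonneg_left (by linarith [hu.2]) hε
      nlinarith
    have h5 : a₁ * ‖x u‖ ^ 2 ≤ a₁ * (a₂ / a₁ * r ^ 2 + m / 2) := by
      have : a₁ * (a₂ / a₁ * r ^ 2 + m / 2) = a₂ * r ^ 2 + a₁ / 2 * m := by field_simp
      linarith
    exact le_of_mul_le_mul_left h5 ha₁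
  have hmle : m ≤ max (r ^ 2) (a₂ / a₁ * r ^ 2 + m / 2) := by
    refine _root_.norm_histAt_sq_le x fun u hu => ?_
    rcases le_total u t₀ with hle | hge
    · refine le_max_of_le_left ?_
      gcongr
      exact norm_apply_le_norm_histAt x (by linarith [hu.1, hs.1]) hle
    · exact le_max_of_le_right (hbd u ⟨hge, hu.2.trans hs.2⟩)
  have hd : 0 ≤ a₂ / a₁ * r ^ 2 := by positivity
  have hr : 0 ≤ r ^ 2 := by positivity
  refine (hm t ⟨ht₀, le_rfl⟩).trans ?_
  rcases le_max_iff.1 hmle with h1 | h1 <;> linarith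

/-- If `‖x‖²` is at least `μ` on a subinterval of length `η`, then `ν` drops accordingly. -/
theorem le_sub_add (h : DissipatesAlong Δ a₁ a₂ a ε b ν x) (ha : 0 < a) (hε : 0 ≤ ε)
    {s e α η μ m : ℝ} (h₀ : 0 ≤ s) (hη : 0 ≤ η) (hsα : s ≤ α) (hαe : α + η ≤ e) (heb : e ≤ b)
    (hm : ∀ t ∈ Icc s e, ‖histAt Δ x t‖ ^ 2 ≤ m)
    (hμ : ∀ t ∈ Icc α (α + η), μ ≤ ‖x t‖ ^ 2) :
    ν e ≤ ν s - a * μ * η + ε * m * (e - s) := by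
  have hle : ∀ t ∈ Icc s e, ε * ‖histAt Δ x t‖ ^ 2 ≤ ε * m := fun t ht =>
    mul_le_mul_of_nonneg_left (hm t ht) hε
  have hweak : ∀ t ∈ Icc s e, -(a * ‖x t‖ ^ 2) + ε * ‖histAt Δ x t‖ ^ 2 ≤ ε * m := fun t ht => by
    have : 0 ≤ a * ‖x t‖ ^ 2 := by positivity
    linarith [hle t ht]
  have h1 := h.le_add_mul (t₁ := s) (t₂ := α) (C := ε * m) h₀ hsα (by linarith)
    fun t ht => hweak t ⟨ht.1, by linarith [ht.2]⟩
  have h2 := h.le_add_mul (t₁ := α) (t₂ := α + η) (C := -(a * μ) + ε * m) (by linarith)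
    (by linarith) (by linarith) fun t ht => by
      have := mul_le_mul_of_nonneg_left (hμ t ⟨ht.1, ht.2.le⟩) ha.le
      linarith [hle t ⟨by linarith [ht.1], by linarith [ht.2]⟩]
  have h3 := h.le_add_mul (t₁ := α + η) (t₂ := e) (C := ε * m) (by linarith) hαe heb
    fun t ht => hweak t ⟨by linarith [ht.1], ht.2.le⟩
  linarith

end DissipatesAlong

/-- One-sided bound on the rate of change of `q` in terms of the history norm along `x`. -/
def OneSidedRate (Δ : ℝ≥0) {n : ℕ} (K b : ℝ) (q : ℝ → ℝ) (x : C(ℝ, Vec n)) : Prop :=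
  ∀ ⦃t₁ t₂ m : ℝ⦄, 0 ≤ t₁ → t₁ ≤ t₂ → t₂ ≤ b →
    (∀ t ∈ Icc t₁ t₂, ‖histAt Δ x t‖ ^ 2 ≤ m) → q t₂ ≤ q t₁ + K * m * (t₂ - t₁)

/-- A large value of `q` persists on an interval of length `η` before or after. -/
theorem exists_Icc_half_le {Δ : ℝ≥0} {n : ℕ} {K b : ℝ} {q : ℝ → ℝ} {x : C(ℝ, Vec n)}
    (hq : OneSidedRate Δ K b q x ∨ OneSidedRate Δ K b (fun t => -q t) x)
    {s e m η d t' : ℝ} (hK : 0 ≤ K) (hm0 : 0 ≤ m) (hη : 0 ≤ η) (h₀ : 0 ≤ s) (heb : e ≤ b)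
    (hm : ∀ t ∈ Icc s e, ‖histAt Δ x t‖ ^ 2 ≤ m) (hd : K * m * η ≤ d / 2)
    (ht' : t' ∈ Icc (s + η) (e - η)) (hqt' : d ≤ q t') :
    ∃ α, s ≤ α ∧ α + η ≤ e ∧ ∀ t ∈ Icc α (α + η), d / 2 ≤ q t := by
  have hKm : 0 ≤ K * m := by positivity
  rcases hq with hq | hq
  · refine ⟨t' - η, by linarith [ht'.1], by linarith [ht'.2], fun t ht => ?_⟩
    have h1 := hq (t₁ := t) (t₂ := t') (m := m) (by linarith [ht.1, ht'.1]) (by linarith [ht.2])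
      (by linarith [ht'.2]) fun u hu => hm u ⟨by linarith [ht.1, hu.1, ht'.1],
        by linarith [hu.2, ht'.2]⟩
    have : K * m * (t' - t) ≤ K * m * η := mul_le_mul_of_nonneg_left (by linarith [ht.1]) hKm
    linarith
  · refine ⟨t', by linarith [ht'.1], by linarith [ht'.2], fun t ht => ?_⟩
    have h1 := hq (t₁ := t') (t₂ := t) (m := m) (by linarith [ht'.1]) ht.1
      (by linarith [ht'.2, ht.2]) fun u hu => hm u ⟨by linarith [hu.1, ht'.1],
        by linarith [hu.2, ht'.2, ht.2]⟩
    have : K * m * (t - t') ≤ K * m * η := mul_le_mul_of_nonneg_left (by linarith [ht.2]) hKm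
    linarith

/-- For small `ε` the history norm is halved after a uniform time. -/
theorem exists_halving_time (Δ : ℝ≥0) (n : ℕ) {a₁ a₂ a K p₁ p₂ : ℝ} (ha₁ : 0 < a₁)
    (ha₂ : 0 < a₂) (ha : 0 < a) (hK : 0 < K) (hp₁ : 0 < p₁) (hp₂ : 0 < p₂) :
    ∃ T : ℝ, 0 < T ∧ ∃ εbar : ℝ, 0 < εbar ∧ ∀ ε : ℝ, 0 ≤ ε → ε < εbar → ε * T ≤ a₁ / 2 ∧
      ∀ (b : ℝ) (ν q : ℝ → ℝ) (x : C(ℝ, Vec n)), DissipatesAlong Δ a₁ a₂ a ε b ν x →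
        (∀ t, p₁ * ‖x t‖ ^ 2 ≤ q t) → (∀ t, q t ≤ p₂ * ‖x t‖ ^ 2) →
        (OneSidedRate Δ K b q x ∨ OneSidedRate Δ K b (fun t => -q t) x) →
        ∀ t₀ : ℝ, 0 ≤ t₀ → t₀ + T ≤ b →
          ‖histAt Δ x (t₀ + T)‖ ≤ 1 / 2 * ‖histAt Δ x t₀‖ := by
  have hΔ : (0 : ℝ) ≤ Δ := Δ.coe_nonneg
  set M : ℝ := 1 + 2 * (a₂ / a₁) with hMdef
  have hM1 : 1 ≤ M := by
    have : 0 < a₂ / a₁ := by positivity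
    linarith
  have hM : 0 < M := by linarith
  set σ : ℝ := a₁ / (8 * (a₁ + a₂)) with hσ
  have hσ0 : 0 < σ := by positivity
  have hσ1 : σ ≤ 1 / 8 := by
    rw [hσ, div_le_div_iff₀ (by positivity) (by norm_num)]; linarith
  have hσ2 : a₂ * σ ≤ a₁ / 8 := by
    rw [hσ, mul_div_assoc', div_le_div_iff₀ (by positivity) (by norm_num)]; nlinarith
  set δ : ℝ := p₁ * σ with hδ
  have hδ0 : 0 < δ := by positivity
  set η : ℝ := δ / (2 * K * M) with hη
  have hη0 : 0 < η := by positivity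
  have hKη : K * M * η = δ / 2 := by rw [hη]; field_simp
  set D : ℝ := a * (δ / (2 * p₂)) * η with hD
  have hD0 : 0 < D := by positivity
  set w : ℝ := Δ + 2 * η with hw
  have hw0 : 0 < w := by positivity
  obtain ⟨N, hN⟩ := exists_nat_gt (2 * a₂ / D)
  have hN0 : (0 : ℝ) < N := lt_trans (by positivity) hN
  rw [div_lt_iff₀ hD0] at hN
  have hT0 : 0 < (N : ℝ) * w := by positivity
  refine ⟨N * w, hT0, min (a₁ / (8 * M * (N * w))) (D / (2 * M * w)), by positivity,
    fun ε hε hεbar => ?_⟩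
  have hε1 : ε * M * (N * w) ≤ a₁ / 8 := by
    have := (hεbar.trans_le (min_le_left _ _)).le
    rw [le_div_iff₀ (by positivity)] at this
    linarith
  have hε2 : ε * M * w ≤ D / 2 := by
    have := (hεbar.trans_le (min_le_right _ _)).le
    rw [le_div_iff₀ (by positivity)] at this
    linarith
  have hεT : ε * (N * w) ≤ a₁ / 2 := by
    have : ε * (N * w) * 1 ≤ ε * (N * w) * M := mul_le_mul_of_nonneg_left hM1 (by positivity)
    linarith
  refine ⟨hεT, fun b ν q x hx hq₁ hq₂ hq t₀ ht₀ hb => ?_⟩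
  set r := ‖histAt Δ x t₀‖ with hr
  have hMr : ∀ t ∈ Icc t₀ (t₀ + N * w), ‖histAt Δ x t‖ ^ 2 ≤ M * r ^ 2 := fun t ht =>
    hx.norm_histAt_sq_le ha₁ ha₂ ha hε hεT ht₀ ht.1 ht.2 (ht.2.trans hb)
  suffices hsq : ‖histAt Δ x (t₀ + N * w)‖ ^ 2 ≤ 1 / 4 * r ^ 2 by
    refine abs_le_of_sq_le_sq' (b := 1 / 2 * r) ?_ (by positivity) |>.2
    linarith
  by_cases hgood : ∃ j : ℕ, j < N ∧
      ∀ t ∈ Icc (t₀ + j * w + η) (t₀ + j * w + η + Δ), q t ≤ δ * r ^ 2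
  · obtain ⟨j, hjN, hj⟩ := hgood
    have hjw : 0 ≤ (j : ℝ) * w := by positivity
    have hjT : ((j : ℝ) + 1) * w ≤ N * w := by
      gcongr
      exact_mod_cast hjN
    have hj1 : ((j : ℝ) + 1) * w = j * w + Δ + 2 * η := by rw [hw]; ring
    set t₁ : ℝ := t₀ + j * w + η + Δ with ht₁
    have hsmall : ∀ t ∈ Icc (t₁ - Δ) t₁, ‖x t‖ ^ 2 ≤ σ * r ^ 2 := fun t ht => by
      have h1 := hj t ⟨by linarith [ht.1], ht.2⟩
      have h2 : p₁ * ‖x t‖ ^ 2 ≤ p₁ * (σ * r ^ 2) := by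
        rw [← mul_assoc]; exact (hq₁ t).trans h1
      exact le_of_mul_le_mul_left h2 hp₁
    have hν₁ : ν t₁ ≤ a₁ / 8 * r ^ 2 := by
      have h1 := mul_le_mul_of_nonneg_left (norm_histAt_sq_le (Δ := Δ) x hsmall) ha₂.le
      have h2 := mul_le_mul_of_nonneg_right hσ2 (sq_nonneg r)
      linarith [hx.upper t₁]
    refine norm_histAt_sq_le x fun t ht => ?_
    rcases le_total t t₁ with hle | hge
    · have h1 := hsmall t ⟨by linarith [ht.1], hle⟩
      have h2 := mul_le_mul_of_nonneg_right hσ1 (sq_nonneg r)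
      have := sq_nonneg r
      linarith
    · have h1 := hx.le_add_mul (t₁ := t₁) (t₂ := t) (C := ε * (M * r ^ 2)) (by positivity) hge
        (ht.2.trans hb) fun u hu => by
          have h2 := mul_le_mul_of_nonneg_left
            (hMr u ⟨by linarith [hu.1], by linarith [hu.2, ht.2]⟩) hε
          have : 0 ≤ a * ‖x u‖ ^ 2 := by positivity
          linarith
      have h2 : ε * (M * r ^ 2) * (t - t₁) ≤ ε * (M * r ^ 2) * (N * w) :=
        mul_le_mul_of_nonneg_left (by linarith [ht.2]) (by positivity)
      have h3 := mul_le_mul_of_nonneg_right hε1 (sq_nonneg r)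
      have h4 : a₁ * ‖x t‖ ^ 2 ≤ a₁ * (1 / 4 * r ^ 2) := by linarith [hx.lower t]
      exact le_of_mul_le_mul_left h4 ha₁
  · push Not at hgood
    have hdrop : ∀ j : ℕ, j ≤ N → ν (t₀ + j * w) ≤ a₂ * r ^ 2 - j * (D / 2 * r ^ 2) := by
      intro j
      induction j with
      | zero => intro _; simpa using hx.upper t₀
      | succ j ih =>
        intro hjN
        have ih := ih (by omega)
        obtain ⟨t', ht', hqt'⟩ := hgood j (by omega)
        have hjw : 0 ≤ (j : ℝ) * w := by positivity
        have hjT : ((j : ℝ) + 1) * w ≤ N * w := by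
          gcongr
          exact_mod_cast hjN
        have hj1 : ((j : ℝ) + 1) * w = j * w + Δ + 2 * η := by rw [hw]; ring
        have hm : ∀ t ∈ Icc (t₀ + j * w) (t₀ + (j + 1) * w), ‖histAt Δ x t‖ ^ 2 ≤ M * r ^ 2 :=
          fun t ht => hMr t ⟨by linarith [ht.1], by linarith [ht.2]⟩
        obtain ⟨α, hα1, hα2, hα⟩ := exists_Icc_half_le hq (s := t₀ + j * w)
          (e := t₀ + (j + 1) * w) (η := η) (d := δ * r ^ 2) hK.le (by positivity) hη0.le
          (by positivity) (by linarith) hm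
          (by rw [show K * (M * r ^ 2) * η = K * M * η * r ^ 2 by ring, hKη]; linarith)
          ⟨ht'.1, by linarith [ht'.2]⟩ hqt'.le
        have h1 := hx.le_sub_add ha hε (μ := δ / (2 * p₂) * r ^ 2) (by positivity) hη0.le hα1 hα2
          (by linarith) hm fun t ht => by
            have h2 := (hα t ht).trans (hq₂ t)
            rw [div_mul_eq_mul_div, div_le_iff₀ (by positivity)]
            linarith
        have h2 := mul_le_mul_of_nonneg_right hε2 (sq_nonneg r)
        have h3 : a * (δ / (2 * p₂) * r ^ 2) * η = D * r ^ 2 := by rw [hD]; ring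
        have h4 : t₀ + (j + 1) * w - (t₀ + j * w) = w := by ring
        rw [h3, h4] at h1
        push_cast
        linarith
    have h1 := hdrop N le_rfl
    have h2 := hx.nonneg (t₀ + N * w)
    have h3 : (a₂ - N * (D / 2)) * r ^ 2 ≥ 0 := by linarith
    have hr2 : r ^ 2 ≤ 0 := by
      by_contra! hpos
      nlinarith
    have h4 := hMr (t₀ + N * w) ⟨by linarith, le_rfl⟩
    have h5 : r ^ 2 = 0 := le_antisymm hr2 (sq_nonneg r)
    rw [h5] at h4 ⊢
    linarith

open scoped RealInnerProductSpace in
theorem IsTrajectory.oneSidedRate_inner {Δ : ℝ≥0} {n : ℕ} {f₀ : Hist Δ n → Vec n}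
    {x : C(ℝ, Vec n)} {b : ℝ} (hx : IsTrajectory f₀ x b) (hf : Continuous f₀)
    {A : Vec n →L[ℝ] Vec n} (hA : ∀ v w : Vec n, ⟪A v, w⟫ = ⟪v, A w⟫) {c : ℝ} (hc : 0 ≤ c)
    (h : ∀ φ : Hist Δ n, ⟪ev0 φ, A (f₀ φ)⟫ ≤ c * ‖φ‖ ^ 2) :
    OneSidedRate Δ (2 * c) b (fun t => ⟪x t, A (x t)⟫) x := by
  intro t₁ t₂ m h0 h12 h2b hm
  refine image_le_of_deriv_right_le_deriv_boundary (f := fun t => ⟪x t, A (x t)⟫)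
    (f' := fun t => ⟪x t, A (f₀ (histAt Δ x t))⟫ + ⟪f₀ (histAt Δ x t), A (x t)⟫)
    (B := fun t => ⟪x t₁, A (x t₁)⟫ + 2 * c * m * (t - t₁))
    (B' := fun _ => 2 * c * m) (a := t₁) (b := t₂) (by fun_prop) ?_ (by simp) (by fun_prop) ?_ ?_
    ⟨h12, le_rfl⟩
  · intro t ht
    have hd := hx.hasDerivWithinAt hf ⟨h0.trans ht.1, ht.2.trans_le h2b⟩
    exact hd.inner ℝ (A.hasFDerivAt.comp_hasDerivWithinAt t hd)
  · intro t _
    simpa using ((((hasDerivAt_id t).sub_const t₁).const_mul (2 * c * m)).const_add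
      ⟪x t₁, A (x t₁)⟫).hasDerivWithinAt
  · intro t ht
    have h1 := h (histAt Δ x t)
    rw [ev0_histAt] at h1
    have h2 : ⟪f₀ (histAt Δ x t), A (x t)⟫ = ⟪x t, A (f₀ (histAt Δ x t))⟫ := by
      rw [← hA, real_inner_comm]
    have h3 := mul_le_mul_of_nonneg_left (hm t ⟨ht.1, ht.2.le⟩) hc
    rw [h2]
    linarith

/-- Halving after every period of length `T` gives exponential decay. -/
theorem norm_histAt_le_exp_of_halving {Δ : ℝ≥0} {n : ℕ} {x : C(ℝ, Vec n)} {b T M : ℝ}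
    (hT : 0 < T) (hM : 1 ≤ M)
    (hgrow : ∀ t₀ t, 0 ≤ t₀ → t₀ ≤ t → t ≤ t₀ + T → t ≤ b →
      ‖histAt Δ x t‖ ^ 2 ≤ M * ‖histAt Δ x t₀‖ ^ 2)
    (hhalf : ∀ t₀, 0 ≤ t₀ → t₀ + T ≤ b → ‖histAt Δ x (t₀ + T)‖ ≤ 1 / 2 * ‖histAt Δ x t₀‖)
    {t : ℝ} (ht : t ∈ Icc 0 b) :
    ‖histAt Δ x t‖ ≤ 2 * M * ‖histAt Δ x 0‖ * Real.exp (-(Real.log 2 / T) * t) := by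
  have hpow : ∀ k : ℕ, k * T ≤ b → ‖histAt Δ x (k * T)‖ ≤ (1 / 2) ^ k * ‖histAt Δ x 0‖ := by
    intro k
    induction k with
    | zero => intro _; simp
    | succ k ih =>
      intro hk
      push_cast at hk ⊢
      have h1 := hhalf (k * T) (by positivity) (by linarith)
      have h2 := ih (by linarith)
      rw [add_one_mul, pow_succ]
      linarith
  set k := ⌊t / T⌋₊
  have hk1 : k * T ≤ t := (le_div_iff₀ hT).1 (Nat.floor_le (div_nonneg ht.1 hT.le))
  have hk2 : t / T < k + 1 := Nat.lt_floor_add_one _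
  have hk2' : t < (k + 1) * T := (div_lt_iff₀ hT).1 hk2
  have h1 := hgrow (k * T) t (by positivity) hk1 (by linarith) ht.2
  have h2 : ‖histAt Δ x t‖ ≤ M * ‖histAt Δ x (k * T)‖ := by
    refine abs_le_of_sq_le_sq' (h1.trans ?_) (by positivity) |>.2
    rw [mul_pow]
    gcongr
    nlinarith
  have h3 : ((1 : ℝ) / 2) ^ k ≤ 2 * Real.exp (-(Real.log 2 / T) * t) := by
    have h4 : ((1 : ℝ) / 2) ^ (k + 1) = Real.exp (-(Real.log 2) * (k + 1 : ℕ)) := by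
      rw [Real.exp_mul, Real.exp_neg, Real.exp_log two_pos, Real.rpow_natCast, one_div]
    have h5 : Real.exp (-(Real.log 2) * (k + 1 : ℕ)) ≤ Real.exp (-(Real.log 2 / T) * t) := by
      rw [Real.exp_le_exp]
      have h6 := mul_le_mul_of_nonneg_left hk2.le (Real.log_nonneg one_le_two)
      push_cast
      have h7 : Real.log 2 / T * t = Real.log 2 * (t / T) := by ring
      linarith
    rw [pow_succ] at h4
    linarith
  calc ‖histAt Δ x t‖ ≤ M * ((1 / 2) ^ k * ‖histAt Δ x 0‖) :=
        h2.trans (mul_le_mul_of_nonneg_left (hpow k (hk1.trans ht.2)) (by linarith))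
    _ ≤ M * (2 * Real.exp (-(Real.log 2 / T) * t) * ‖histAt Δ x 0‖) := by gcongr
    _ = _ := by ring

/-! ### Continuation of bounded solutions -/

/-- The curve that follows `x` up to time `T` and has velocity `z` afterwards. -/
noncomputable def glueVelocity {n : ℕ} (x : C(ℝ, Vec n)) {T S : ℝ} (hTS : T ≤ S) (z : C(Icc T S, Vec n)) :
    C(ℝ, Vec n) where
  toFun u := x (min u T) + ∫ s in T..max u T, IccExtend hTS z s
  continuous_toFun := by
    have hz : Continuous (IccExtend hTS z) := z.continuous.Icc_extend'
    have h1 : Continuous fun u => ∫ s in T..u, IccExtend hTS z s :=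
      continuous_iff_continuousAt.2 fun u =>
        (hz.integral_hasStrictDerivAt T u).hasDerivAt.continuousAt
    exact (x.continuous.comp (by fun_prop)).add (h1.comp (by fun_prop))

theorem norm_histAt_glueVelocity_sub_le {Δ : ℝ≥0} {n : ℕ} (x : C(ℝ, Vec n)) {T S : ℝ}
    (hTS : T ≤ S) (z z' : C(Icc T S, Vec n)) {t : ℝ} (ht : t ∈ Icc T S) :
    ‖histAt Δ (glueVelocity x hTS z) t - histAt Δ (glueVelocity x hTS z') t‖
      ≤ ‖z - z'‖ * (S - T) := by
  rw [ContinuousMap.norm_le _ (mul_nonneg (norm_nonneg _) (by linarith))]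
  rintro ⟨τ, hτ⟩
  have hz : Continuous (IccExtend hTS z) := z.continuous.Icc_extend'
  have hz' : Continuous (IccExtend hTS z') := z'.continuous.Icc_extend'
  simp only [ContinuousMap.sub_apply, histAt, glueVelocity, ContinuousMap.coe_mk,
    add_sub_add_left_eq_sub]
  rw [← intervalIntegral.integral_sub (hz.intervalIntegrable _ _) (hz'.intervalIntegrable _ _)]
  refine (intervalIntegral.norm_integral_le_of_norm_le_const (C := ‖z - z'‖) fun s _ =>
    (z - z').norm_coe_le_norm _).trans ?_
  rw [abs_of_nonneg (by simp)]
  refine mul_le_mul_of_nonneg_left (sub_le_sub_right (max_le ?_ hTS) _) (norm_nonneg _)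
  linarith [hτ.2, ht.2]

theorem norm_histAt_glueVelocity_le {Δ : ℝ≥0} {n : ℕ} (x : C(ℝ, Vec n)) {T S : ℝ}
    (hTS : T ≤ S) (z : C(Icc T S, Vec n)) {t : ℝ} (ht : t ∈ Icc T S) :
    ‖histAt Δ (glueVelocity x hTS z) t‖ ≤ ‖histAt Δ x T‖ + ‖z‖ * (S - T) := by
  have h0 : ‖histAt Δ (glueVelocity x hTS 0) t‖ ≤ ‖histAt Δ x T‖ := by
    refine norm_histAt_le _ (norm_nonneg _) fun s hs => ?_
    have : glueVelocity x hTS 0 s = x (min s T) := by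
      simp [glueVelocity, IccExtend]
    rw [this]
    refine norm_apply_le_norm_histAt x (le_min ?_ ?_) (min_le_right _ _)
    · linarith [hs.1, ht.1]
    · linarith [Δ.coe_nonneg]
  have h1 := norm_histAt_glueVelocity_sub_le (Δ := Δ) x hTS z 0 ht
  rw [sub_zero] at h1
  have h2 := norm_sub_norm_le (histAt Δ (glueVelocity x hTS z) t)
    (histAt Δ (glueVelocity x hTS 0) t)
  linarith

/-- Any continuous curve can be continued beyond time `T` by a solution of the equation. -/
theorem LipOnBounded₀.exists_continuation {Δ : ℝ≥0} {n : ℕ} {f₀ : Hist Δ n → Vec n}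
    (hf : LipOnBounded₀ f₀) (hf0 : f₀ 0 = 0) (x : C(ℝ, Vec n)) (T : ℝ) :
    ∃ S, T < S ∧ ∃ y : C(ℝ, Vec n), (∀ t ≤ T, y t = x t) ∧
      ∀ t ∈ Icc T S, y t = x T + ∫ s in T..t, f₀ (histAt Δ y s) := by
  set R := ‖histAt Δ x T‖
  obtain ⟨L, hL, hlip⟩ := hf (R + 1) (by positivity)
  set F := L * (R + 1)
  have hF : 0 < F := by positivity
  set δ := 1 / (2 * (L + F)) with hδ
  have hδ0 : 0 < δ := by positivity
  have hδ1 : δ * (2 * (L + F)) = 1 := by rw [hδ]; field_simp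
  have hδL : L * δ ≤ 1 / 2 := by nlinarith
  have hδF : F * δ ≤ 1 := by nlinarith
  have hTS : T ≤ T + δ := by linarith
  let Γ : C(Icc T (T + δ), Vec n) → C(Icc T (T + δ), Vec n) := fun z =>
    ⟨fun s => f₀ (histAt Δ (glueVelocity x hTS z) s),
      hf.continuous.comp ((continuous_histAt Δ _).comp continuous_subtype_val)⟩
  set B := Metric.closedBall (0 : C(Icc T (T + δ), Vec n)) F
  have hR : ∀ z ∈ B, ∀ s : Icc T (T + δ),
      ‖histAt Δ (glueVelocity x hTS z) s‖ ≤ R + 1 := fun z hz s => by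
    have hz : ‖z‖ ≤ F := by simpa [B] using hz
    refine (norm_histAt_glueVelocity_le x hTS z s.2).trans ?_
    have : ‖z‖ * (T + δ - T) ≤ F * δ := by
      rw [add_sub_cancel_left]; gcongr
    linarith
  have hmaps : MapsTo Γ B B := fun z hz => by
    simp only [B, Metric.mem_closedBall, dist_zero_right]
    rw [ContinuousMap.norm_le _ hF.le]
    intro s
    have h1 := hlip _ 0 (hR z hz s) (by simp; positivity)
    rw [hf0, sub_zero, sub_zero] at h1
    exact h1.trans (mul_le_mul_of_nonneg_left (hR z hz s) hL.le)
  have hcontr : ContractingWith (1 / 2 : ℝ≥0) (hmaps.restrict Γ B B) := by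
    refine ⟨by rw [← NNReal.coe_lt_coe]; norm_num, LipschitzWith.of_dist_le_mul ?_⟩
    rintro ⟨z, hz⟩ ⟨z', hz'⟩
    rw [Subtype.dist_eq, Subtype.dist_eq, dist_eq_norm, dist_eq_norm,
      ContinuousMap.norm_le _ (by positivity)]
    intro s
    refine (hlip _ _ (hR z hz s) (hR z' hz' s)).trans ?_
    have h1 := norm_histAt_glueVelocity_sub_le (Δ := Δ) x hTS z z' s.2
    rw [add_sub_cancel_left] at h1
    have h2 := mul_le_mul_of_nonneg_right hδL (norm_nonneg (z - z'))
    have h3 := mul_le_mul_of_nonneg_left h1 hL.le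
    simp only [NNReal.coe_div, NNReal.coe_one, NNReal.coe_ofNat]
    linarith
  obtain ⟨z, -, hz, -⟩ := hcontr.exists_fixedPoint' (x := 0)
    Metric.isClosed_closedBall.isComplete hmaps (by simp [B, hF.le]) (edist_ne_top _ _)
  refine ⟨T + δ, by linarith, glueVelocity x hTS z, fun t ht => ?_, fun t ht => ?_⟩
  · simp [glueVelocity, min_eq_left ht, max_eq_right ht]
  · simp only [glueVelocity, ContinuousMap.coe_mk, min_eq_right ht.1, max_eq_left ht.1]
    congr 1
    refine intervalIntegral.integral_congr fun s hs => ?_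
    rw [uIcc_of_le ht.1] at hs
    have hs' : s ∈ Icc T (T + δ) := ⟨hs.1, hs.2.trans ht.2⟩
    rw [IccExtend_of_mem hTS _ hs']
    exact (DFunLike.congr_fun hz ⟨s, hs'⟩).symm

/-- A continuous curve on all of `ℝ` agreeing with a solution on `[-Δ, b]`. -/
theorem IsSolution₀.exists_isTrajectory {Δ : ℝ≥0} {n : ℕ} {f₀ : Hist Δ n → Vec n}
    {x₀ : Hist Δ n} {tmax : EReal} {x : ℝ → Vec n} (hx : IsSolution₀ Δ f₀ x₀ tmax x) {b : ℝ}
    (hb : 0 ≤ b) (hbt : (b : EReal) < tmax) :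
    ∃ y : C(ℝ, Vec n), (∀ t ∈ Icc (-(Δ : ℝ)) b, y t = x t) ∧ IsTrajectory f₀ y b ∧
      histAt Δ y 0 = x₀ := by
  have hΔb : -(Δ : ℝ) ≤ b := (neg_nonpos.2 Δ.coe_nonneg).trans hb
  have hcont : ContinuousOn x (Icc (-(Δ : ℝ)) b) := hx.cont.mono fun s hs =>
    ⟨hs.1, (EReal.coe_le_coe_iff.2 hs.2).trans_lt hbt⟩
  let y : C(ℝ, Vec n) := ⟨IccExtend hΔb ((Icc (-(Δ : ℝ)) b).domRestrict x),
    hcont.domRestrict.Icc_extend'⟩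
  have hy : ∀ t ∈ Icc (-(Δ : ℝ)) b, y t = x t := fun t ht =>
    IccExtend_of_mem hΔb ((Icc (-(Δ : ℝ)) b).domRestrict x) ht
  refine ⟨y, hy, fun t ht => ?_, ?_⟩
  · rw [hy t ⟨by linarith [ht.1, Δ.coe_nonneg], ht.2⟩, hy 0 ⟨by simp, hb⟩,
      hx.integral_eq t ht.1 ((EReal.coe_le_coe_iff.2 ht.2).trans_lt hbt)]
    congr 1
    refine intervalIntegral.integral_congr fun s hs => ?_
    rw [uIcc_of_le ht.1] at hs
    rw [seg_eq_histAt (y := y) fun u hu => (hy u ⟨?_, ?_⟩).symm]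
    · linarith [hu.1, hs.1]
    · linarith [hu.2, hs.2, ht.2]
  · ext1 τ
    rw [← hx.init τ, ← hy τ.1 ⟨τ.2.1, τ.2.2.trans hb⟩]
    simp [histAt]

theorem IsTrajectory.isSolution₀ {Δ : ℝ≥0} {n : ℕ} {f₀ : Hist Δ n → Vec n} {y : C(ℝ, Vec n)}
    {b : ℝ} (hy : IsTrajectory f₀ y b) (hf : Continuous f₀) (hb : 0 < b) :
    IsSolution₀ Δ f₀ (histAt Δ y 0) b y where
  tmax_pos := by exact_mod_cast hb
  cont := y.continuous.continuousOn
  init τ := by simp [histAt]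
  integrable t _ _ := by
    simp only [seg_eq_histAt (x := y) (y := y) fun _ _ => rfl]
    exact (hf.comp (continuous_histAt Δ y)).intervalIntegrable _ _
  integral_eq t h0 ht := by
    simp only [seg_eq_histAt (x := y) (y := y) fun _ _ => rfl]
    exact hy t ⟨h0, (EReal.coe_lt_coe_iff.1 ht).le⟩

/-- A solution that stays bounded up to a finite time `T` is not maximal. -/
theorem IsMaxSolution₀.not_bounded {Δ : ℝ≥0} {n : ℕ} {f₀ : Hist Δ n → Vec n}
    (hf : LipOnBounded₀ f₀) (hf0 : f₀ 0 = 0) {x₀ : Hist Δ n} {T : ℝ} {x : ℝ → Vec n}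
    (hx : IsMaxSolution₀ Δ f₀ x₀ T x) {R : ℝ} (hR : ∀ t ∈ Ico 0 T, ‖x t‖ ≤ R) : False := by
  obtain ⟨hsol, hmax⟩ := hx
  have hsol : IsSolution₀ Δ f₀ x₀ T x := hsol
  have hT : 0 < T := by exact_mod_cast hsol.tmax_pos
  have hΔ : (0 : ℝ) ≤ Δ := Δ.coe_nonneg
  set Q : ℝ := max R ‖x₀‖ + 1
  have hQ : 0 < Q := by positivity
  obtain ⟨L, hL, hlip⟩ := hf Q hQ
  have hxQ : ∀ t ∈ Ico (-(Δ : ℝ)) T, ‖x t‖ ≤ Q := by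
    intro t ht
    rcases le_total 0 t with h | h
    · linarith [hR t ⟨h, ht.2⟩, le_max_left R ‖x₀‖]
    · rw [hsol.init ⟨t, ht.1, h⟩]
      linarith [x₀.norm_coe_le_norm ⟨t, ht.1, h⟩, le_max_right R ‖x₀‖]
  have hinc : ∀ s ∈ Ico 0 T, ∀ t ∈ Ico 0 T, s ≤ t → ‖x t - x s‖ ≤ L * Q * (t - s) := by
    intro s hs t ht hst
    obtain ⟨y, hy, hytraj, -⟩ := hsol.exists_isTrajectory ht.1 (EReal.coe_lt_coe_iff.2 ht.2)
    have hc : Continuous fun u => f₀ (histAt Δ y u) :=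
      hf.continuous.comp (continuous_histAt Δ y)
    rw [← hy t ⟨by linarith [ht.1], le_rfl⟩, ← hy s ⟨by linarith [hs.1], hst⟩,
      hytraj t ⟨ht.1, le_rfl⟩, hytraj s ⟨hs.1, hst⟩, add_sub_add_left_eq_sub,
      intervalIntegral.integral_interval_sub_left (hc.intervalIntegrable _ _)
        (hc.intervalIntegrable _ _), ← abs_of_nonneg (sub_nonneg.2 hst)]
    refine intervalIntegral.norm_integral_le_of_norm_le_const fun u hu => ?_
    rw [uIoc_of_le hst] at hu
    have h1 : ‖histAt Δ y u‖ ≤ Q := norm_histAt_le y hQ.le fun v hv => by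
      have h2 : -(Δ : ℝ) ≤ v := by linarith [hv.1, hu.1, hs.1]
      have h3 : v ≤ t := hv.2.trans hu.2
      rw [hy v ⟨h2, h3⟩]
      exact hxQ v ⟨h2, h3.trans_lt ht.2⟩
    have h4 := hlip _ 0 h1 (by simpa using hQ.le)
    rw [hf0, sub_zero, sub_zero] at h4
    exact h4.trans (mul_le_mul_of_nonneg_left h1 hL.le)
  have hLip : LipschitzOnWith (L * Q).toNNReal x (Ico 0 T) := by
    refine LipschitzOnWith.of_dist_le_mul fun s hs t ht => ?_
    rw [Real.coe_toNNReal _ (by positivity), dist_eq_norm, Real.dist_eq]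
    rcases le_total s t with h | h
    · rw [norm_sub_rev, abs_sub_comm, abs_of_nonneg (sub_nonneg.2 h)]
      exact hinc s hs t ht h
    · rw [abs_of_nonneg (sub_nonneg.2 h)]
      exact hinc t ht s hs h
  obtain ⟨g, hg, hxg⟩ := hLip.extend_finite_dimension
  have hgc : Continuous g := hg.continuous
  have hΔ' : -(Δ : ℝ) ≤ 0 := neg_nonpos.2 hΔ
  let X : C(ℝ, Vec n) := ⟨fun t => x₀ (projIcc _ _ hΔ' t) + (g (max t 0) - g 0), by fun_prop⟩
  have hX : ∀ t ∈ Ico (-(Δ : ℝ)) T, X t = x t := by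
    intro t ht
    simp only [X, ContinuousMap.coe_mk]
    rcases le_total t 0 with h | h
    · rw [projIcc_of_mem _ ⟨ht.1, h⟩, max_eq_right h, sub_self, add_zero, ← hsol.init]
    · rw [projIcc_of_right_le _ h, max_eq_left h, ← hxg ⟨h, ht.2⟩, ← hxg ⟨le_rfl, hT⟩,
        ← hsol.init]
      abel
  have hXc : Continuous fun s => f₀ (histAt Δ X s) :=
    hf.continuous.comp (continuous_histAt Δ X)
  have hprim : Continuous fun t => ∫ s in (0 : ℝ)..t, f₀ (histAt Δ X s) :=
    continuous_iff_continuousAt.2 fun u =>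
      (hXc.integral_hasStrictDerivAt 0 u).hasDerivAt.continuousAt
  have hXtraj : IsTrajectory f₀ X T := by
    have h1 : EqOn X (fun t => X 0 + ∫ s in (0 : ℝ)..t, f₀ (histAt Δ X s)) (Ico 0 T) := by
      intro t ht
      simp only
      rw [hX t ⟨by linarith [ht.1], ht.2⟩, hX 0 ⟨hΔ', hT⟩,
        hsol.integral_eq t ht.1 (EReal.coe_lt_coe_iff.2 ht.2)]
      congr 1
      refine intervalIntegral.integral_congr fun s hs => ?_
      rw [uIcc_of_le ht.1] at hs
      rw [seg_eq_histAt (y := X) fun u hu => (hX u ⟨?_, ?_⟩).symm]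
      · linarith [hu.1, hs.1]
      · linarith [hu.2, hs.2, ht.2]
    have h2 := h1.closure X.continuous (continuous_const.add hprim)
    rw [closure_Ico hT.ne] at h2
    exact h2
  obtain ⟨S, hTS, y, hyX, hy⟩ := hf.exists_continuation hf0 X T
  have hyc : Continuous fun s => f₀ (histAt Δ y s) :=
    hf.continuous.comp (continuous_histAt Δ y)
  have hytraj₁ : ∀ t ∈ Icc 0 T, y t = y 0 + ∫ s in (0 : ℝ)..t, f₀ (histAt Δ y s) := by
    intro t ht
    rw [hyX t ht.2, hyX 0 hT.le, hXtraj t ht]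
    congr 1
    refine intervalIntegral.integral_congr fun s hs => ?_
    rw [uIcc_of_le ht.1] at hs
    rw [histAt_congr fun u hu => (hyX u (by linarith [hu.2, hs.2, ht.2])).symm]
  have hytraj : IsTrajectory f₀ y S := by
    intro t ht
    rcases le_total t T with h | h
    · exact hytraj₁ t ⟨ht.1, h⟩
    · rw [hy t ⟨h, ht.2⟩, ← hyX T le_rfl, hytraj₁ T ⟨hT.le, le_rfl⟩, add_assoc,
        intervalIntegral.integral_add_adjacent_intervals (hyc.intervalIntegrable _ _)
          (hyc.intervalIntegrable _ _)]
  have hinit : histAt Δ y 0 = x₀ := by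
    ext1 τ
    have hτ : τ.1 < T := τ.2.2.trans_lt hT
    rw [← hsol.init τ, ← hX τ.1 ⟨τ.2.1, hτ⟩, ← hyX τ.1 hτ.le]
    simp [histAt]
  have hle := hmax S y (hinit ▸ hytraj.isSolution₀ hf.continuous (hT.trans hTS))
    fun t ht htT => by
      have htT : t < T := EReal.coe_lt_coe_iff.1 htT
      rw [hyX t htT.le, hX t ⟨ht, htT⟩]
  exact absurd (EReal.coe_le_coe_iff.1 hle) (not_le.2 hTS)

/-- A positive definite matrix is bounded below by a positive multiple of the identity. -/
theorem Matrix.PosDef.exists_pos_mul_norm_sq_le_inner {n : ℕ} {P : Matrix (Fin n) (Fin n) ℝ}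
    (hP : P.PosDef) :
    ∃ p : ℝ, 0 < p ∧ ∀ v : Vec n, p * ‖v‖ ^ 2 ≤ inner ℝ v (Matrix.toEuclideanCLM (𝕜 := ℝ) P v) := by
  set A := Matrix.toEuclideanCLM (𝕜 := ℝ) P
  have hpos : ∀ v : Vec n, v ≠ 0 → 0 < inner ℝ v (A v) := fun v hv => by
    rw [Matrix.inner_toEuclideanCLM]
    simpa using hP.dotProduct_mulVec_pos (x := v.ofLp) (by simpa using hv)
  rcases (Metric.sphere (0 : Vec n) 1).eq_empty_or_nonempty with he | hne
  · refine ⟨1, one_pos, fun v => ?_⟩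
    have hv : v = 0 := by
      by_contra hv
      have hmem : ‖v‖⁻¹ • v ∈ Metric.sphere (0 : Vec n) 1 := by
        simp [norm_smul, inv_mul_cancel₀ (norm_ne_zero_iff.2 hv)]
      simp [he] at hmem
    simp [hv]
  · obtain ⟨u, hu, hmin⟩ := (isCompact_sphere (0 : Vec n) 1).exists_isMinOn hne
      (f := fun v => inner ℝ v (A v)) (by fun_prop)
    have hu0 : u ≠ 0 := by
      rintro rfl
      simp at hu
    refine ⟨inner ℝ u (A u), hpos u hu0, fun v => ?_⟩
    rcases eq_or_ne v 0 with rfl | hv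
    · simp
    have hv' : ‖v‖ ≠ 0 := norm_ne_zero_iff.2 hv
    have hmem : ‖v‖⁻¹ • v ∈ Metric.sphere (0 : Vec n) 1 := by
      simp [norm_smul, inv_mul_cancel₀ hv']
    have h1 : inner ℝ u (A u) ≤ inner ℝ (‖v‖⁻¹ • v) (A (‖v‖⁻¹ • v)) := hmin hmem
    rw [map_smul, real_inner_smul_left, real_inner_smul_right] at h1
    calc inner ℝ u (A u) * ‖v‖ ^ 2
        ≤ ‖v‖⁻¹ * (‖v‖⁻¹ * inner ℝ v (A v)) * ‖v‖ ^ 2 := by gcongr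
      _ = inner ℝ v (A v) := by field_simp

open Matrix in
/-- GES under a point-wise dissipation and a one-sided quadratic growth
condition on the vector field. -/
theorem ges_of_pointwise_dissipation
    (Δ : ℝ≥0) (n : ℕ) (f₀ : Hist Δ n → Vec n)
    (hf : LipOnBounded₀ f₀) (hf0 : f₀ 0 = 0)
    (V : Hist Δ n → ℝ) (hVnonneg : ∀ φ, 0 ≤ V φ) (hVlip : LipOnBoundedV V)
    (a₁ a₂ a : ℝ) (ha₁ : 0 < a₁) (ha₂ : 0 < a₂) (ha : 0 < a)
    (hbounds : ∀ φ : Hist Δ n, a₁ * ‖ev0 φ‖ ^ 2 ≤ V φ ∧ V φ ≤ a₂ * ‖φ‖ ^ 2)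
    (P : Matrix (Fin n) (Fin n) ℝ) (hPsymm : P.IsSymm) (hPpos : P.PosDef)
    (c : ℝ) (hc : 0 < c)
    (hP : (∀ φ : Hist Δ n, ev0 φ ⬝ᵥ P.mulVec (f₀ φ) ≤ c * ‖φ‖ ^ 2) ∨
          (∀ φ : Hist Δ n, -(c * ‖φ‖ ^ 2) ≤ ev0 φ ⬝ᵥ P.mulVec (f₀ φ))) :
    ∃ εbar : ℝ, 0 < εbar ∧ ∀ ε : ℝ, 0 ≤ ε → ε < εbar →
      (∀ φ : Hist Δ n, driverD V φ (f₀ φ)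
          ≤ ((-(a * ‖ev0 φ‖ ^ 2) + ε * ‖φ‖ ^ 2 : ℝ) : EReal)) →
      GES Δ f₀ := by
  classical
  set A : Vec n →L[ℝ] Vec n := Matrix.toEuclideanCLM (𝕜 := ℝ) P with hA
  obtain ⟨p₁, hp₁, hq₁⟩ := hPpos.exists_pos_mul_norm_sq_le_inner
  have hq₂ : ∀ v : Vec n, inner ℝ v (A v) ≤ (‖A‖ + 1) * ‖v‖ ^ 2 := fun v => by
    have h1 := real_inner_le_norm v (A v)
    have h2 := mul_le_mul_of_nonneg_left (A.le_opNorm v) (norm_nonneg v)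
    have h3 := sq_nonneg ‖v‖
    linarith
  have hsymm : ∀ v w : Vec n, inner ℝ (A v) w = inner ℝ v (A w) := fun v w => by
    rw [real_inner_comm, hA, Matrix.inner_toEuclideanCLM, Matrix.inner_toEuclideanCLM,
      Matrix.dotProduct_mulVec, ← Matrix.mulVec_transpose, hPsymm.eq, dotProduct_comm]
  have hcf := hf.continuous
  obtain ⟨T, hT, εbar, hεbar, hhalf⟩ := exists_halving_time Δ n (K := 2 * c) ha₁ ha₂ ha
    (by positivity) hp₁ (by positivity : 0 < ‖A‖ + 1)
  refine ⟨εbar, hεbar, fun ε hε hlt hdiss => ?_⟩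
  obtain ⟨hεT, hhalf⟩ := hhalf ε hε hlt
  set M : ℝ := 1 + 2 * (a₂ / a₁)
  have hM : 1 ≤ M := by
    have : 0 < a₂ / a₁ := by positivity
    linarith
  have hdecay : ∀ (x : C(ℝ, Vec n)) (b : ℝ), IsTrajectory f₀ x b → ∀ t ∈ Icc 0 b,
      ‖histAt Δ x t‖ ≤ 2 * M * ‖histAt Δ x 0‖ * Real.exp (-(Real.log 2 / T) * t) := by
    intro x b hx t ht
    have hD := hx.dissipatesAlong hcf hVnonneg hVlip hbounds hdiss
    refine norm_histAt_le_exp_of_halving hT hM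
      (fun t₀ t h0 h1 h2 h3 => hD.norm_histAt_sq_le ha₁ ha₂ ha hε hεT h0 h1 h2 h3)
      (hhalf b _ (fun t => inner ℝ (x t) (A (x t))) x hD (fun t => hq₁ (x t))
        (fun t => hq₂ (x t)) ?_) ht
    refine hP.imp (fun h => hx.oneSidedRate_inner hcf hsymm hc.le fun φ => ?_) fun h => ?_
    · rw [hA, Matrix.inner_toEuclideanCLM]
      exact h φ
    · have h1 := hx.oneSidedRate_inner hcf (A := -A) (c := c) (fun v w => by simp [hsymm]) hc.le
        fun φ => by
          have h2 := h φ
          rw [_root_.neg_apply, inner_neg_right, hA, Matrix.inner_toEuclideanCLM]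
          linarith
      simpa using h1
  have hbound : ∀ (x₀ : Hist Δ n) (tmax : EReal) (x : ℝ → Vec n), IsSolution₀ Δ f₀ x₀ tmax x →
      ∀ t : ℝ, 0 ≤ t → (t : EReal) < tmax →
        ‖x t‖ ≤ 2 * M * ‖x₀‖ * Real.exp (-(Real.log 2 / T) * t) := by
    intro x₀ tmax x hx t ht htm
    obtain ⟨y, hy, hytraj, hy0⟩ := hx.exists_isTrajectory ht htm
    rw [← hy0, ← hy t ⟨by linarith [Δ.coe_nonneg], le_rfl⟩]
    exact (norm_apply_le_norm_histAt y (by simp) le_rfl).trans (hdecay y t hytraj t ⟨ht, le_rfl⟩)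
  have hlam : 0 < Real.log 2 / T := div_pos (Real.log_pos one_lt_two) hT
  refine ⟨2 * M, by linarith, Real.log 2 / T, hlam, fun x₀ tmax x hx => ?_⟩
  have htop : tmax = ⊤ := by
    induction tmax with
    | bot => exact absurd hx.1.tmax_pos (by simp)
    | top => rfl
    | coe S =>
      refine (hx.not_bounded hf hf0 (R := 2 * M * ‖x₀‖) fun t ht => ?_).elim
      refine (hbound x₀ S x hx.1 t ht.1 (EReal.coe_lt_coe_iff.2 ht.2)).trans ?_
      refine mul_le_of_le_one_right (by positivity) (Real.exp_le_one_iff.2 ?_)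
      nlinarith [ht.1]
  exact ⟨htop, fun t ht => hbound x₀ tmax x hx.1 t ht (htop ▸ EReal.coe_lt_top t)⟩
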